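/- arXiv:1706.04901 — 2 statements merged into one kernel-verified Lean document; each statement's English description precedes it below -/
import Mathlib

section
/- Let n ≥ 1, let E and F be Köthe sequence spaces, let α ∈ ℂ^ℕ and C ≥ 0. Then the following are equivalent: (a) α·x_1⋯x_n ∈ F^{××} and ‖α·x_1⋯x_n‖_{F^{××}} ≤ C·‖x_1‖_E⋯‖x_n‖_E for all x_1,…,x_n ∈ E; (b) α·x_1⋯x_n ∈ F^{××} and ‖α·x_1⋯x_n‖_{F^{××}} ≤ C·‖x_1‖_{E^{××}}⋯‖x_n‖_{E^{××}} for all x_1,…,x_n ∈ E^{××}. In particular the diagonal n-linear operator associated with α has the same operator norm as a map E × ⋯ × E → F^{××} and as a map E^{××} × ⋯ × E^{××} → F^{××}. (This is the isometric identity ℓ_n(𝓛;E,F^{××}) = ℓ_n(𝓛;E^{××},F^{××}) from the paper, in the case of the ideal of all bounded multilinear operators.) -/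
/-- A Köthe sequence space: a linear subspace of `ℂ^ℕ` with a complete norm such that
`ℓ₁ ⊆ E ⊆ ℓ_∞` with inclusions of norm at most 1, and which is normal. -/
structure KotheSpace : Type where
  Mem : (ℕ → ℂ) → Prop
  nrm : (ℕ → ℂ) → ℝ
  mem_zero : Mem 0
  mem_add : ∀ {x y : ℕ → ℂ}, Mem x → Mem y → Mem (x + y)
  mem_smul : ∀ (c : ℂ) {x : ℕ → ℂ}, Mem x → Mem (c • x)
  nrm_add_le : ∀ {x y : ℕ → ℂ}, Mem x → Mem y → nrm (x + y) ≤ nrm x + nrm y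
  nrm_smul : ∀ (c : ℂ) {x : ℕ → ℂ}, Mem x → nrm (c • x) = ‖c‖ * nrm x
  nrm_eq_zero_iff : ∀ {x : ℕ → ℂ}, Mem x → (nrm x = 0 ↔ x = 0)
  l1_mem : ∀ {x : ℕ → ℂ}, Summable (fun k => ‖x k‖) → Mem x
  nrm_le_l1 : ∀ {x : ℕ → ℂ}, Summable (fun k => ‖x k‖) → nrm x ≤ ∑' k, ‖x k‖
  coord_le_nrm : ∀ {x : ℕ → ℂ}, Mem x → ∀ k, ‖x k‖ ≤ nrm x
  normal_mem : ∀ {x y : ℕ → ℂ}, Mem y → (∀ k, ‖x k‖ ≤ ‖y k‖) → Mem x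
  normal_nrm : ∀ {x y : ℕ → ℂ}, Mem x → Mem y → (∀ k, ‖x k‖ ≤ ‖y k‖) → nrm x ≤ nrm y
  complete : ∀ f : ℕ → ℕ → ℂ, (∀ i, Mem (f i)) →
    (∀ ε : ℝ, 0 < ε → ∃ N, ∀ i, N ≤ i → ∀ j, N ≤ j → nrm (f i - f j) < ε) →
    ∃ g, Mem g ∧ ∀ ε : ℝ, 0 < ε → ∃ N, ∀ i, N ≤ i → nrm (f i - g) < ε

namespace KotheSpace

/-- Membership in the Köthe dual `E^×`. -/
def dualMem (E : KotheSpace) (z : ℕ → ℂ) : Prop :=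
  ∀ x, E.Mem x → Summable fun k => ‖z k * x k‖

/-- The norm of the Köthe dual `E^×`. -/
noncomputable def dualNrm (E : KotheSpace) (z : ℕ → ℂ) : ℝ :=
  sSup {r | ∃ x, E.Mem x ∧ E.nrm x ≤ 1 ∧ r = ∑' k, ‖z k * x k‖}

/-- Membership in the Köthe bidual `E^××`. -/
def bidualMem (E : KotheSpace) (z : ℕ → ℂ) : Prop :=
  ∀ w, E.dualMem w → Summable fun k => ‖z k * w k‖

/-- The norm of the Köthe bidual `E^××`. -/
noncomputable def bidualNrm (E : KotheSpace) (z : ℕ → ℂ) : ℝ :=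
  sSup {r | ∃ w, E.dualMem w ∧ E.dualNrm w ≤ 1 ∧ r = ∑' k, ‖z k * w k‖}

end KotheSpace

open scoped BigOperators

namespace KotheSpace

lemma nrm_nonneg (E : KotheSpace) {x : ℕ → ℂ} (hx : E.Mem x) : 0 ≤ E.nrm x :=
  (norm_nonneg _).trans (E.coord_le_nrm hx 0)

lemma dualNrm_nonneg (E : KotheSpace) (z : ℕ → ℂ) : 0 ≤ E.dualNrm z := by
  apply Real.sSup_nonneg
  rintro r ⟨x, -, -, rfl⟩
  exact tsum_nonneg fun _ => norm_nonneg _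

lemma bidualNrm_nonneg (E : KotheSpace) (z : ℕ → ℂ) : 0 ≤ E.bidualNrm z := by
  apply Real.sSup_nonneg
  rintro r ⟨x, -, -, rfl⟩
  exact tsum_nonneg fun _ => norm_nonneg _

lemma mem_single (E : KotheSpace) (k : ℕ) : E.Mem (Pi.single k 1) := by
  apply E.l1_mem
  apply summable_of_ne_finset_zero (s := {k})
  intro b hb
  simp at hb
  simp [hb]

/-- A gliding hump criterion: if every sequence in `B` has its geometrically weighted terms
dominated by a single sequence pairing absolutely with `z`, then `z` is bounded on `B`. -/
lemma bddAbove_of_exists_dominating {B : Set (ℕ → ℂ)} {z : ℕ → ℂ}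
    (hB : ∀ u : ℕ → ℕ → ℂ, (∀ j, u j ∈ B) → ∃ x : ℕ → ℂ, (Summable fun k => ‖z k * x k‖) ∧
      ∀ j k, (1 / 2 : ℝ) ^ j * ‖u j k‖ ≤ ‖x k‖)
    (hz : ∀ u ∈ B, Summable fun k => ‖z k * u k‖) :
    ∃ M, ∀ u ∈ B, ∑' k, ‖z k * u k‖ ≤ M := by
  by_contra! h
  choose u huB hu using fun j : ℕ => h (2 ^ j * j)
  obtain ⟨x, hx, hux⟩ := hB u huB
  obtain ⟨j, hj⟩ := exists_nat_gt (∑' k, ‖z k * x k‖)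
  have h1 : (1 / 2 : ℝ) ^ j * ∑' k, ‖z k * u j k‖ ≤ ∑' k, ‖z k * x k‖ := by
    rw [← tsum_mul_left]
    refine ((hz _ (huB j)).mul_left _).tsum_le_tsum (fun k => ?_) hx
    rw [norm_mul, norm_mul, mul_left_comm]
    exact mul_le_mul_of_nonneg_left (hux j k) (norm_nonneg _)
  have h2 : (1 / 2 : ℝ) ^ j * (2 ^ j * j) < (1 / 2 : ℝ) ^ j * ∑' k, ‖z k * u j k‖ :=
    mul_lt_mul_of_pos_left (hu j) (by positivity)
  rw [← mul_assoc, ← mul_pow] at h2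
  rw [one_div_mul_cancel two_ne_zero, one_pow, one_mul] at h2
  linarith

lemma exists_mem_dominating (E : KotheSpace) (u : ℕ → ℕ → ℂ)
    (hu : ∀ j, E.Mem (u j) ∧ E.nrm (u j) ≤ 1) :
    ∃ x, E.Mem x ∧ ∀ j k, (1 / 2 : ℝ) ^ j * ‖u j k‖ ≤ ‖x k‖ := by
  let a : ℕ → ℕ → ℂ := fun j k => ((‖u j k‖ : ℝ) : ℂ)
  have ha : ∀ j, E.Mem (a j) := fun j => E.normal_mem (hu j).1 fun k => by simp [a]
  have han : ∀ j, E.nrm (a j) ≤ 1 := fun j =>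
    (E.normal_nrm (ha j) (hu j).1 fun k => by simp [a]).trans (hu j).2
  let f : ℕ → ℕ → ℂ := fun i => ∑ j ∈ Finset.range i, ((1 / 2 : ℂ) ^ j) • a j
  have hfs : ∀ i, f (i + 1) = f i + ((1 / 2 : ℂ) ^ i) • a i := fun i =>
    Finset.sum_range_succ _ _
  have hf : ∀ i, E.Mem (f i) := by
    intro i
    induction i with
    | zero => simpa [f] using E.mem_zero
    | succ i ih => rw [hfs]; exact E.mem_add ih (E.mem_smul _ (ha i))
  have hsub : ∀ {x y : ℕ → ℂ}, E.Mem x → E.Mem y → E.Mem (x - y) := by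
    intro x y hx hy
    have := E.mem_add hx (E.mem_smul (-1) hy)
    rwa [neg_one_smul, ← sub_eq_add_neg] at this
  have hsymm : ∀ {x y : ℕ → ℂ}, E.Mem x → E.Mem y → E.nrm (x - y) = E.nrm (y - x) := by
    intro x y hx hy
    have := E.nrm_smul (-1) (hsub hx hy)
    rw [neg_one_smul, neg_sub] at this
    simpa using this.symm
  have hdist : ∀ i m, E.nrm (f (i + m) - f i) ≤ 2 * (1 / 2 : ℝ) ^ i - 2 * (1 / 2 : ℝ) ^ (i + m) := by
    intro i m
    induction m with
    | zero => simp [(E.nrm_eq_zero_iff E.mem_zero).2]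
    | succ m ih =>
      rw [← add_assoc, hfs, add_sub_right_comm]
      refine (E.nrm_add_le (hsub (hf _) (hf _)) (E.mem_smul _ (ha _))).trans ?_
      rw [E.nrm_smul _ (ha _), pow_succ]
      have : ‖(1 / 2 : ℂ) ^ (i + m)‖ * E.nrm (a (i + m)) ≤ (1 / 2 : ℝ) ^ (i + m) * 1 := by
        rw [norm_pow, norm_div, norm_one, Complex.norm_ofNat]
        exact mul_le_mul_of_nonneg_left (han _) (by positivity)
      linarith
  have hdist' : ∀ i j, i ≤ j → E.nrm (f j - f i) ≤ 2 * (1 / 2 : ℝ) ^ i := by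
    intro i j hij
    obtain ⟨m, rfl⟩ := Nat.exists_eq_add_of_le hij
    have : (0 : ℝ) < (1 / 2) ^ (i + m) := by positivity
    linarith [hdist i m]
  obtain ⟨g, hg, hlim⟩ := E.complete f hf (by
    intro ε hε
    obtain ⟨N, hN⟩ := exists_pow_lt_of_lt_one (half_pos hε) (by norm_num : (1 / 2 : ℝ) < 1)
    have key : ∀ i j, N ≤ i → i ≤ j → E.nrm (f j - f i) < ε := fun i j hi hij => by
      have : (1 / 2 : ℝ) ^ i ≤ (1 / 2) ^ N :=
        pow_le_pow_of_le_one (by norm_num) (by norm_num) hi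
      linarith [hdist' i j hij]
    refine ⟨N, fun i hi j hj => ?_⟩
    rcases le_total i j with h | h
    · rw [hsymm (hf _) (hf _)]; exact key i j hi h
    · exact key j i hj h)
  refine ⟨g, hg, fun j k => ?_⟩
  apply le_of_forall_pos_le_add
  intro ε hε
  obtain ⟨N, hN⟩ := hlim ε hε
  set i := max N (j + 1)
  have h1 : ‖f i k - g k‖ < ε :=
    (E.coord_le_nrm (hsub (hf i) hg) k).trans_lt (hN i (le_max_left _ _))
  have hfi : f i k = ((∑ l ∈ Finset.range i, (1 / 2 : ℝ) ^ l * ‖u l k‖ : ℝ) : ℂ) := by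
    simp [f, a, Finset.sum_apply]
  have h2 : (1 / 2 : ℝ) ^ j * ‖u j k‖ ≤ ‖f i k‖ := by
    rw [hfi, Complex.norm_real]
    refine le_trans ?_ (le_abs_self _)
    exact Finset.single_le_sum (f := fun l => (1 / 2 : ℝ) ^ l * ‖u l k‖)
      (fun l _ => by positivity)
      (Finset.mem_range.2 (lt_of_lt_of_le (Nat.lt_succ_self j) (le_max_right _ _)))
  have h3 : ‖f i k‖ - ‖g k‖ ≤ ‖f i k - g k‖ := norm_sub_norm_le _ _
  linarith

lemma tsum_le_dualNrm (E : KotheSpace) {z x : ℕ → ℂ} (hz : E.dualMem z) (hx : E.Mem x)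
    (hx1 : E.nrm x ≤ 1) : ∑' k, ‖z k * x k‖ ≤ E.dualNrm z := by
  obtain ⟨M, hM⟩ := bddAbove_of_exists_dominating (B := {x | E.Mem x ∧ E.nrm x ≤ 1}) (z := z)
    (fun u hu => (E.exists_mem_dominating u hu).imp fun x hx => ⟨hz x hx.1, hx.2⟩)
    (fun u hu => hz u hu.1)
  refine le_csSup ⟨M, ?_⟩ ⟨x, hx, hx1, rfl⟩
  rintro r ⟨x, hx, hx1, rfl⟩
  exact hM x ⟨hx, hx1⟩

lemma tsum_le_dualNrm_mul_nrm (E : KotheSpace) {z x : ℕ → ℂ} (hz : E.dualMem z)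
    (hx : E.Mem x) : ∑' k, ‖z k * x k‖ ≤ E.dualNrm z * E.nrm x := by
  rcases (E.nrm_nonneg hx).eq_or_lt with h | h
  · have := (E.nrm_eq_zero_iff hx).1 h.symm
    simp [this, (E.nrm_eq_zero_iff E.mem_zero).2]
  · have hn : ‖((E.nrm x : ℂ))⁻¹‖ = (E.nrm x)⁻¹ := by
      rw [norm_inv, Complex.norm_real, Real.norm_of_nonneg h.le]
    have := E.tsum_le_dualNrm hz (E.mem_smul ((E.nrm x : ℂ))⁻¹ hx)
      (by rw [E.nrm_smul _ hx, hn, inv_mul_cancel₀ h.ne'])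
    simp only [Pi.smul_apply, smul_eq_mul, mul_left_comm _ (((E.nrm x : ℂ))⁻¹), norm_mul _ (_ * _),
      hn, tsum_mul_left] at this
    rwa [inv_mul_le_iff₀ h, mul_comm] at this

lemma dualNrm_le (E : KotheSpace) {z : ℕ → ℂ} {M : ℝ} (hM : 0 ≤ M)
    (h : ∀ x, E.Mem x → ∑' k, ‖z k * x k‖ ≤ M * E.nrm x) : E.dualNrm z ≤ M := by
  apply Real.sSup_le _ hM
  rintro r ⟨x, hx, hx1, rfl⟩
  exact (h x hx).trans (mul_le_of_le_one_right hM hx1)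

lemma exists_dualMem_dominating (E : KotheSpace) (u : ℕ → ℕ → ℂ)
    (hu : ∀ j, E.dualMem (u j) ∧ E.dualNrm (u j) ≤ 1) :
    ∃ x, E.dualMem x ∧ ∀ j k, (1 / 2 : ℝ) ^ j * ‖u j k‖ ≤ ‖x k‖ := by
  have key : ∀ y, E.Mem y →
      Summable fun p : ℕ × ℕ => (1 / 2 : ℝ) ^ p.1 * ‖u p.1 p.2 * y p.2‖ := by
    intro y hy
    refine (summable_prod_of_nonneg fun p => mul_nonneg (by positivity) (norm_nonneg _)).2
      ⟨fun j => ((hu j).1 y hy).mul_left ((1 / 2 : ℝ) ^ j), ?_⟩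
    simp only [tsum_mul_left]
    refine Summable.of_nonneg_of_le
      (fun j => mul_nonneg (by positivity) (tsum_nonneg fun k => norm_nonneg _)) (fun j => ?_)
      (summable_geometric_two.mul_right (E.nrm y))
    refine mul_le_mul_of_nonneg_left ?_ (by positivity)
    exact (E.tsum_le_dualNrm_mul_nrm (hu j).1 hy).trans
      (mul_le_of_le_one_left (E.nrm_nonneg hy) (hu j).2)
  have hs : ∀ k, Summable fun j => (1 / 2 : ℝ) ^ j * ‖u j k‖ := by
    intro k
    have := (key _ (E.mem_single k)).prod_symm.prod_factor k
    simpa using this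
  have hnn : ∀ k, 0 ≤ ∑' j, (1 / 2 : ℝ) ^ j * ‖u j k‖ := fun k =>
    tsum_nonneg fun j => by positivity
  refine ⟨fun k => ((∑' j, (1 / 2 : ℝ) ^ j * ‖u j k‖ : ℝ) : ℂ), fun y hy => ?_, fun j k => ?_⟩
  · refine (key y hy).prod_symm.prod.congr fun k => ?_
    rw [norm_mul, Complex.norm_real, Real.norm_of_nonneg (hnn k), ← tsum_mul_right]
    simp [mul_assoc]
  · rw [Complex.norm_real, Real.norm_of_nonneg (hnn k)]
    exact (hs k).le_tsum j fun l _ => by positivity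

lemma tsum_le_bidualNrm (E : KotheSpace) {z w : ℕ → ℂ} (hz : E.bidualMem z)
    (hw : E.dualMem w) (hw1 : E.dualNrm w ≤ 1) : ∑' k, ‖z k * w k‖ ≤ E.bidualNrm z := by
  obtain ⟨M, hM⟩ := bddAbove_of_exists_dominating
    (B := {w | E.dualMem w ∧ E.dualNrm w ≤ 1}) (z := z)
    (fun u hu => (E.exists_dualMem_dominating u hu).imp fun x hx => ⟨hz x hx.1, hx.2⟩)
    (fun u hu => hz u hu.1)
  refine le_csSup ⟨M, ?_⟩ ⟨w, hw, hw1, rfl⟩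
  rintro r ⟨w, hw, hw1, rfl⟩
  exact hM w ⟨hw, hw1⟩

lemma eq_zero_of_dualNrm_eq_zero (E : KotheSpace) {w : ℕ → ℂ} (hw : E.dualMem w)
    (h : E.dualNrm w = 0) : w = 0 := by
  ext k
  have h1 := E.tsum_le_dualNrm_mul_nrm hw (E.mem_single k)
  have h2 := (hw _ (E.mem_single k)).le_tsum k fun _ _ => norm_nonneg _
  rw [h, zero_mul] at h1
  simpa using h2.trans h1

lemma tsum_le_bidualNrm_mul_dualNrm (E : KotheSpace) {z w : ℕ → ℂ} (hz : E.bidualMem z)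
    (hw : E.dualMem w) : ∑' k, ‖z k * w k‖ ≤ E.bidualNrm z * E.dualNrm w := by
  rcases (E.dualNrm_nonneg w).eq_or_lt with h | h
  · rw [← h]
    simp [E.eq_zero_of_dualNrm_eq_zero hw h.symm]
  · have hn : ‖((E.dualNrm w : ℂ))⁻¹‖ = (E.dualNrm w)⁻¹ := by
      rw [norm_inv, Complex.norm_real, Real.norm_of_nonneg h.le]
    have hmul : ∀ y : ℕ → ℂ, ∀ k, ‖(((E.dualNrm w : ℂ))⁻¹ • w) k * y k‖ =
        (E.dualNrm w)⁻¹ * ‖w k * y k‖ := fun y k => by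
      rw [Pi.smul_apply, smul_eq_mul, mul_assoc, norm_mul, hn]
    have := E.tsum_le_bidualNrm (w := ((E.dualNrm w : ℂ))⁻¹ • w) hz
      (fun y hy => by simpa only [hmul] using (hw y hy).mul_left _)
      (E.dualNrm_le zero_le_one fun y hy => by
        simp only [hmul, tsum_mul_left, one_mul]
        rw [inv_mul_le_iff₀ h]
        exact E.tsum_le_dualNrm_mul_nrm hw hy)
    simp only [mul_comm (z _), hmul, tsum_mul_left] at this ⊢
    rwa [inv_mul_le_iff₀ h, mul_comm] at this

lemma bidualNrm_le (E : KotheSpace) {z : ℕ → ℂ} {M : ℝ} (hM : 0 ≤ M)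
    (h : ∀ w, E.dualMem w → ∑' k, ‖z k * w k‖ ≤ M * E.dualNrm w) : E.bidualNrm z ≤ M := by
  apply Real.sSup_le _ hM
  rintro r ⟨w, hw, hw1, rfl⟩
  exact (h w hw).trans (mul_le_of_le_one_right hM hw1)

lemma bidualMem_of_mem (E : KotheSpace) {x : ℕ → ℂ} (hx : E.Mem x) : E.bidualMem x :=
  fun w hw => by simpa only [mul_comm] using hw x hx

lemma bidualNrm_le_nrm (E : KotheSpace) {x : ℕ → ℂ} (hx : E.Mem x) :
    E.bidualNrm x ≤ E.nrm x :=
  E.bidualNrm_le (E.nrm_nonneg hx) fun w hw => by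
    simpa only [mul_comm] using E.tsum_le_dualNrm_mul_nrm hw hx

/-- A weighted `ℓ₁` bound on `E` extends to the bidual `E^××` with the same constant. -/
lemma bound_extends_to_bidual (E : KotheSpace) {v : ℕ → ℂ} {M : ℝ} (hM : 0 ≤ M)
    (h : ∀ x, E.Mem x → (Summable fun k => ‖v k * x k‖) ∧ ∑' k, ‖v k * x k‖ ≤ M * E.nrm x)
    {x : ℕ → ℂ} (hx : E.bidualMem x) :
    (Summable fun k => ‖v k * x k‖) ∧ ∑' k, ‖v k * x k‖ ≤ M * E.bidualNrm x := by
  have hv : E.dualMem v := fun y hy => (h y hy).1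
  refine ⟨by simpa only [mul_comm] using hx v hv, ?_⟩
  have h1 := E.tsum_le_bidualNrm_mul_dualNrm hx hv
  have h2 := mul_le_mul_of_nonneg_left (E.dualNrm_le hM fun y hy => (h y hy).2)
    (E.bidualNrm_nonneg x)
  simpa only [mul_comm] using h1.trans h2

/-- A multilinear weighted `ℓ₁` bound on `E` persists when the variables indexed by `s` range
over the bidual `E^××`. -/
lemma multilinear_bound_extends {ι : Type*} [Fintype ι] [DecidableEq ι] (E : KotheSpace)
    {v : ℕ → ℂ} {M : ℝ} (hM : 0 ≤ M)
    (h : ∀ x : ι → ℕ → ℂ, (∀ i, E.Mem (x i)) → (Summable fun k => ‖v k * ∏ i, x i k‖) ∧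
      ∑' k, ‖v k * ∏ i, x i k‖ ≤ M * ∏ i, E.nrm (x i)) (s : Finset ι) :
    ∀ x : ι → ℕ → ℂ, (∀ i ∈ s, E.bidualMem (x i)) → (∀ i ∉ s, E.Mem (x i)) →
      (Summable fun k => ‖v k * ∏ i, x i k‖) ∧
      ∑' k, ‖v k * ∏ i, x i k‖ ≤
        M * ∏ i, if i ∈ s then E.bidualNrm (x i) else E.nrm (x i) := by
  induction s using Finset.induction_on with
  | empty => exact fun x _ hx => by simpa using h x fun i => hx i (by simp)
  | insert a s ha ih =>
    intro x hxs hx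
    have hprod : ∀ (y : ℕ → ℂ) k, v k * ∏ i, Function.update x a y i k =
        (v k * ∏ i ∈ Finset.univ.erase a, x i k) * y k := fun y k => by
      rw [← Finset.mul_prod_erase _ _ (Finset.mem_univ a), Function.update_self,
        Finset.prod_congr rfl fun i hi => by
          rw [Function.update_of_ne (Finset.ne_of_mem_erase hi)]]
      ring
    have hN : 0 ≤ M * ∏ i ∈ Finset.univ.erase a,
        if i ∈ s then E.bidualNrm (x i) else E.nrm (x i) := by
      refine mul_nonneg hM (Finset.prod_nonneg fun i hi => ?_)
      split_ifs with his
      · exact E.bidualNrm_nonneg _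
      · exact E.nrm_nonneg (hx i (by simp [his, Finset.ne_of_mem_erase hi]))
    have key := E.bound_extends_to_bidual (v := fun k => v k * ∏ i ∈ Finset.univ.erase a, x i k)
      hN (fun y hy => by
        have := ih (Function.update x a y)
          (fun i hi => by
            rw [Function.update_of_ne (ne_of_mem_of_not_mem hi ha)]
            exact hxs i (Finset.mem_insert_of_mem hi))
          (fun i hi => by
            rcases eq_or_ne i a with rfl | hia
            · simpa using hy
            · rw [Function.update_of_ne hia]
              exact hx i (by simp [hi, hia]))
        simp only [hprod] at this
        refine ⟨this.1, this.2.trans_eq ?_⟩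
        rw [← Finset.mul_prod_erase _ _ (Finset.mem_univ a), Function.update_self, if_neg ha,
          Finset.prod_congr rfl fun i hi => by
            rw [Function.update_of_ne (Finset.ne_of_mem_erase hi)]]
        ring) (hxs a (Finset.mem_insert_self a s))
    simp only [← hprod, Function.update_eq_self] at key
    have hcongr : ∏ i ∈ Finset.univ.erase a,
          (if i ∈ insert a s then E.bidualNrm (x i) else E.nrm (x i)) =
        ∏ i ∈ Finset.univ.erase a, if i ∈ s then E.bidualNrm (x i) else E.nrm (x i) :=
      Finset.prod_congr rfl fun i hi => if_congr
        (Finset.mem_insert.trans (or_iff_right (Finset.ne_of_mem_erase hi))) rfl rfl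
    refine ⟨key.1, key.2.trans_eq ?_⟩
    rw [← Finset.mul_prod_erase _ (fun i => if i ∈ insert a s then E.bidualNrm (x i) else _)
        (Finset.mem_univ a), if_pos (Finset.mem_insert_self a s), hcongr]
    ring

end KotheSpace

/-- The isometric identity `ℓ_n(𝓛; E, F^{××}) = ℓ_n(𝓛; E^{××}, F^{××})` for the ideal of all
bounded multilinear operators: the diagonal `n`-linear operator associated with `α` maps
`E × ⋯ × E` into `F^{××}` with norm bound `C` iff it maps `E^{××} × ⋯ × E^{××}` into
`F^{××}` with the same bound. -/
theorem diag_bidual_eq (n : ℕ) (hn : 1 ≤ n) (E F : KotheSpace) (α : ℕ → ℂ) (C : ℝ) (hC : 0 ≤ C) :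
    (∀ x : Fin n → ℕ → ℂ, (∀ i, E.Mem (x i)) →
        F.bidualMem (fun k => α k * ∏ i, x i k) ∧
        F.bidualNrm (fun k => α k * ∏ i, x i k) ≤ C * ∏ i, E.nrm (x i)) ↔
      (∀ x : Fin n → ℕ → ℂ, (∀ i, E.bidualMem (x i)) →
        F.bidualMem (fun k => α k * ∏ i, x i k) ∧
        F.bidualNrm (fun k => α k * ∏ i, x i k) ≤ C * ∏ i, E.bidualNrm (x i)) := by
  constructor
  · intro h x hx
    have hN : 0 ≤ ∏ i, E.bidualNrm (x i) := Finset.prod_nonneg fun i _ => E.bidualNrm_nonneg _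
    have key : ∀ w, F.dualMem w → (Summable fun k => ‖(α k * ∏ i, x i k) * w k‖) ∧
        ∑' k, ‖(α k * ∏ i, x i k) * w k‖ ≤ (C * ∏ i, E.bidualNrm (x i)) * F.dualNrm w := by
      intro w hw
      have := E.multilinear_bound_extends (ι := Fin n) (v := fun k => α k * w k)
        (mul_nonneg hC (F.dualNrm_nonneg w)) (fun y hy => by
          obtain ⟨h1, h2⟩ := h y hy
          have h3 := (F.tsum_le_bidualNrm_mul_dualNrm h1 hw).trans
            (mul_le_mul_of_nonneg_right h2 (F.dualNrm_nonneg w))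
          have h4 := h1 w hw
          simp only [mul_right_comm _ _ (w _)] at h3 h4
          exact ⟨h4, h3.trans_eq (mul_right_comm _ _ _)⟩) Finset.univ x (fun i _ => hx i)
        (fun i hi => absurd (Finset.mem_univ i) hi)
      simp only [Finset.mem_univ, if_true, mul_right_comm _ (w _)] at this
      exact ⟨this.1, this.2.trans_eq (mul_right_comm _ _ _)⟩
    exact ⟨fun w hw => (key w hw).1,
      F.bidualNrm_le (mul_nonneg hC hN) fun w hw => (key w hw).2⟩
  · intro h x hx
    obtain ⟨h1, h2⟩ := h x fun i => E.bidualMem_of_mem (hx i)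
    exact ⟨h1, h2.trans (mul_le_mul_of_nonneg_left (Finset.prod_le_prod
      (fun i _ => E.bidualNrm_nonneg _) fun i _ => E.bidualNrm_le_nrm (hx i)) hC)⟩
end

section
/- Let n ≥ 1, let 1 ≤ p < q < ∞ and define r by 1/r = 1/p − 1/q. Let E be a Köthe sequence space such that (|x(k)|^n)_k ∈ E for every x ∈ ℓ_p, and set G = ℓ_n(𝓛;ℓ_r,E). Let X_1,…,X_n, Y be Banach spaces and let T : X_1 × ⋯ × X_n → Y be a bounded n-linear map satisfying the (E,p)-summing inequality with constant C. Then T satisfies the (G,q)-summing inequality with constant C. (Inclusion theorem: every (E,p)-summing n-linear operator is (ℓ_n(𝓛;ℓ_r,E),q)-summing.) -/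
open scoped BigOperators

/-- The weak `ℓ_p` norm of a finite family in a Banach space:
`w_p(x) = sup{(∑_i ‖x'(x_i)‖^p)^{1/p} : x' ∈ X', ‖x'‖ ≤ 1}`. -/
noncomputable def weakLp (p : ℝ) {X : Type*} [NormedAddCommGroup X] [NormedSpace ℂ X]
    {m : ℕ} (x : Fin m → X) : ℝ :=
  sSup {r | ∃ f : X →L[ℂ] ℂ, ‖f‖ ≤ 1 ∧ r = (∑ i, ‖f (x i)‖ ^ p) ^ (1 / p)}

/-- A bounded `n`-linear map `T` satisfies the `(H,p)`-summing inequality with constant `C`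
(where `H` is given by a membership predicate `HMem` and a norm `Hnrm` on `ℂ^ℕ`):
for all finite families the finitely supported sequence `i ↦ ‖T(x_{1,i},…,x_{n,i})‖`
belongs to `H` with `H`-norm at most `C·w_p(x_1)⋯w_p(x_n)`. -/
def SummingIneq (HMem : (ℕ → ℂ) → Prop) (Hnrm : (ℕ → ℂ) → ℝ) (p : ℝ) {n : ℕ}
    {X : Fin n → Type*} [∀ j, NormedAddCommGroup (X j)] [∀ j, NormedSpace ℂ (X j)]
    {Y : Type*} [NormedAddCommGroup Y] [NormedSpace ℂ Y]
    (T : ContinuousMultilinearMap ℂ X Y) (C : ℝ) : Prop :=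
  ∀ (m : ℕ) (x : ∀ j, Fin m → X j),
    HMem (fun i => if h : i < m then Complex.ofReal ‖T (fun j => x j ⟨i, h⟩)‖ else 0) ∧
    Hnrm (fun i => if h : i < m then Complex.ofReal ‖T (fun j => x j ⟨i, h⟩)‖ else 0) ≤
      C * ∏ j, weakLp p (x j)

/-- The `(H,p)`-summing inequality with constant `C` for a linear operator. -/
def SummingIneqLin (HMem : (ℕ → ℂ) → Prop) (Hnrm : (ℕ → ℂ) → ℝ) (p : ℝ)
    {X Y : Type*} [NormedAddCommGroup X] [NormedSpace ℂ X]
    [NormedAddCommGroup Y] [NormedSpace ℂ Y] (A : X →L[ℂ] Y) (C : ℝ) : Prop :=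
  ∀ (m : ℕ) (x : Fin m → X),
    HMem (fun i => if h : i < m then Complex.ofReal ‖A (x ⟨i, h⟩)‖ else 0) ∧
    Hnrm (fun i => if h : i < m then Complex.ofReal ‖A (x ⟨i, h⟩)‖ else 0) ≤ C * weakLp p x

/-- Membership in the Köthe sequence space `ℓ_n(𝓛; ℓ_r, E)` of diagonal bounded `n`-linear
operators from `ℓ_r` into `E`: bounded sequences `α` with `α·z_1⋯z_n ∈ E` for all
`z_1,…,z_n ∈ ℓ_r`. -/
def lnLMem (n : ℕ) (r : ℝ) (E : KotheSpace) (α : ℕ → ℂ) : Prop :=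
  (∃ M : ℝ, ∀ k, ‖α k‖ ≤ M) ∧
  ∀ z : Fin n → ℕ → ℂ, (∀ i, Summable fun k => ‖z i k‖ ^ r) →
    E.Mem fun k => α k * ∏ i, z i k

/-- The norm of `ℓ_n(𝓛; ℓ_r, E)`:
`‖α‖ = sup{‖α·z_1⋯z_n‖_E : ‖z_j‖_{ℓ_r} ≤ 1}`. -/
noncomputable def lnLNrm (n : ℕ) (r : ℝ) (E : KotheSpace) (α : ℕ → ℂ) : ℝ :=
  sSup {s | ∃ z : Fin n → ℕ → ℂ,
    (∀ i, Summable (fun k => ‖z i k‖ ^ r) ∧ (∑' k, ‖z i k‖ ^ r) ^ (1 / r) ≤ 1) ∧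
    s = E.nrm fun k => α k * ∏ i, z i k}

section weakLp

variable {X : Type*} [NormedAddCommGroup X] [NormedSpace ℂ X] {m : ℕ}

theorem weakLp_nonneg (p : ℝ) (x : Fin m → X) : 0 ≤ weakLp p x := by
  refine Real.sSup_nonneg ?_
  rintro _ ⟨f, -, rfl⟩
  positivity

theorem le_weakLp {q : ℝ} (hq : 0 < q) (x : Fin m → X) {f : X →L[ℂ] ℂ} (hf : ‖f‖ ≤ 1) :
    (∑ i, ‖f (x i)‖ ^ q) ^ (1 / q) ≤ weakLp q x := by
  refine le_csSup ⟨(∑ i, ‖x i‖ ^ q) ^ (1 / q), ?_⟩ ⟨f, hf, rfl⟩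
  rintro _ ⟨g, hg, rfl⟩
  gcongr with i
  exact g.le_of_opNorm_le hg (x i) |>.trans_eq (one_mul _)

/-- Multiplying a family by scalars in the unit ball of `ℓ_r` turns the weak `ℓ_q` norm into a
bound for the weak `ℓ_p` norm, where `1/p = 1/q + 1/r`. -/
theorem weakLp_smul_le {p q r : ℝ} (h : r.HolderTriple q p) (x : Fin m → X) {c : Fin m → ℂ}
    (hc : (∑ i, ‖c i‖ ^ r) ^ (1 / r) ≤ 1) :
    weakLp p (fun i => c i • x i) ≤ weakLp q x := by
  refine Real.sSup_le ?_ (weakLp_nonneg q x)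
  rintro _ ⟨f, hf, rfl⟩
  simp only [map_smul, norm_smul]
  calc (∑ i, (‖c i‖ * ‖f (x i)‖) ^ p) ^ (1 / p)
      ≤ (∑ i, ‖c i‖ ^ r) ^ (1 / r) * (∑ i, ‖f (x i)‖ ^ q) ^ (1 / q) :=
        by simpa using NNReal.coe_le_coe.2 (NNReal.Lr_le_Lp_mul_Lq Finset.univ
          (fun i => ‖c i‖₊) (fun i => ‖f (x i)‖₊) h)
    _ ≤ 1 * weakLp q x :=
        mul_le_mul hc (le_weakLp h.symm.pos x hf) (by positivity) zero_le_one
    _ = weakLp q x := one_mul _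

end weakLp

theorem KotheSpace.mem_of_eq_zero_of_le (E : KotheSpace) {x : ℕ → ℂ} {m : ℕ}
    (hx : ∀ k, m ≤ k → x k = 0) : E.Mem x := by
  refine E.l1_mem (summable_of_ne_finset_zero (s := Finset.range m) fun k hk => ?_)
  rw [hx k (by simpa using hk), norm_zero]

theorem lnLMem_of_eq_zero_of_le (n : ℕ) (r : ℝ) (E : KotheSpace) {x : ℕ → ℂ} {m : ℕ}
    (hx : ∀ k, m ≤ k → x k = 0) : lnLMem n r E x := by
  refine ⟨⟨∑ k ∈ Finset.range m, ‖x k‖, fun k => ?_⟩, fun z _ =>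
    E.mem_of_eq_zero_of_le fun k hk => by rw [hx k hk, zero_mul]⟩
  rcases lt_or_ge k m with hk | hk
  · exact Finset.single_le_sum (f := fun k => ‖x k‖) (fun _ _ => norm_nonneg _)
      (Finset.mem_range.2 hk)
  · rw [hx k hk, norm_zero]
    positivity

/-- Inclusion theorem for `(E,p)`-summing multilinear operators: for `1 ≤ p < q` and
`1/r = 1/p - 1/q`, every `(E,p)`-summing `n`-linear operator (with constant `C`) is
`(ℓ_n(𝓛;ℓ_r,E), q)`-summing (with the same constant `C`). -/
theorem summing_inclusion (n : ℕ) (hn : 1 ≤ n) (p q r : ℝ) (hp : 1 ≤ p) (hpq : p < q)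
    (hr : 1 / r = 1 / p - 1 / q) (E : KotheSpace)
    (hE : ∀ x : ℕ → ℂ, Summable (fun k => ‖x k‖ ^ p) →
      E.Mem (fun k => Complex.ofReal (‖x k‖ ^ n)))
    {X : Fin n → Type*} [∀ j, NormedAddCommGroup (X j)] [∀ j, NormedSpace ℂ (X j)]
    {Y : Type*} [NormedAddCommGroup Y] [NormedSpace ℂ Y]
    (T : ContinuousMultilinearMap ℂ X Y) (C : ℝ) (hC : 0 ≤ C)
    (hT : SummingIneq E.Mem E.nrm p T C) :
    SummingIneq (lnLMem n r E) (lnLNrm n r E) q T C := by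
  intro m x
  have hp0 : 0 < p := one_pos.trans_le hp
  have hr0 : 0 < 1 / r := by
    rw [hr, sub_pos]
    exact one_div_lt_one_div_of_lt hp0 hpq
  have hrqp : r.HolderTriple q p :=
    ⟨by simp only [one_div] at hr; linarith, one_div_pos.1 hr0, hp0.trans hpq⟩
  refine ⟨lnLMem_of_eq_zero_of_le n r E (m := m) fun k hk => dif_neg hk.not_gt, ?_⟩
  refine Real.sSup_le ?_ (mul_nonneg hC (Finset.prod_nonneg fun j _ => weakLp_nonneg q (x j)))
  rintro _ ⟨z, hz, rfl⟩
  obtain ⟨hmem, hle⟩ := hT m fun j i => z j i • x j i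
  have hnrm : E.nrm (fun k => (if h : k < m then
        Complex.ofReal ‖T (fun j => x j ⟨k, h⟩)‖ else 0) * ∏ j, z j k) ≤
      E.nrm (fun k => if h : k < m then
        Complex.ofReal ‖T (fun j => z j k • x j ⟨k, h⟩)‖ else 0) := by
    refine E.normal_nrm (E.mem_of_eq_zero_of_le (m := m) fun k hk => ?_) hmem fun k => ?_
    · rw [dif_neg hk.not_gt, zero_mul]
    · by_cases h : k < m
      · simp only [dif_pos h]
        rw [T.map_smul_univ (fun j => z j k) fun j => x j ⟨k, h⟩]
        simp [norm_smul, mul_comm]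
      · simp [dif_neg h]
  refine hnrm.trans (hle.trans (mul_le_mul_of_nonneg_left ?_ hC))
  refine Finset.prod_le_prod (fun j _ => weakLp_nonneg p _) fun j _ =>
    weakLp_smul_le hrqp (x j) (le_trans ?_ (hz j).2)
  refine Real.rpow_le_rpow (by positivity) ?_ hr0.le
  rw [Fin.sum_univ_eq_sum_range (fun k => ‖z j k‖ ^ r) m]
  exact (hz j).1.sum_le_tsum _ fun k _ => by positivity
end
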